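/- arXiv:2110.08002 — 5 statements merged into one kernel-verified Lean document; each statement's English description precedes it below -/
import Mathlib

section
/- Let H be a real inner product space, let N ≥ 1, and let V_0, V_1, …, V_N and V_* be linear subspaces of H such that V_* ⊆ V_n for every n = 0, …, N. Suppose X_0, …, X_N and Y_0, …, Y_N are elements of H with X_n ∈ V_n and Y_n ∈ V_n for each n, suppose d_1, …, d_N ∈ H and s_1, …, s_N ∈ V_*, and suppose that Y_0 = X_0 and that for every n = 1, …, N and every φ ∈ V_n one has ⟨X_n − X_{n−1}, φ⟩ = ⟨d_n, φ⟩ + ⟨s_n, φ⟩ and ⟨Y_n − Y_{n−1}, φ⟩ = ⟨d_n, φ⟩. Then Y_n = X_n − Σ_{i=1}^{n} s_i for every n = 1, …, N. -/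
open RealInnerProductSpace

/-- Abstract discrete transformation lemma: if `X` solves the scheme with noise
increments `s n` lying in a fixed subspace `Vstar` contained in every `V n`, and `Y`
solves the noise-free transformed scheme, then `Y n = X n - ∑_{i=1}^n s i`. -/
theorem stmt_0 {H : Type*} [NormedAddCommGroup H] [InnerProductSpace ℝ H]
    (N : ℕ) (hN : 1 ≤ N)
    (V : ℕ → Submodule ℝ H) (Vstar : Submodule ℝ H)
    (hVs : ∀ n, n ≤ N → Vstar ≤ V n)
    (X Y d s : ℕ → H)
    (hX : ∀ n, n ≤ N → X n ∈ V n)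
    (hY : ∀ n, n ≤ N → Y n ∈ V n)
    (hs : ∀ n, 1 ≤ n → n ≤ N → s n ∈ Vstar)
    (hY0 : Y 0 = X 0)
    (hXeq : ∀ n, 1 ≤ n → n ≤ N → ∀ φ ∈ V n,
      ⟪X n - X (n - 1), φ⟫ = ⟪d n, φ⟫ + ⟪s n, φ⟫)
    (hYeq : ∀ n, 1 ≤ n → n ≤ N → ∀ φ ∈ V n,
      ⟪Y n - Y (n - 1), φ⟫ = ⟪d n, φ⟫) :
    ∀ n, 1 ≤ n → n ≤ N → Y n = X n - ∑ i ∈ Finset.Icc 1 n, s i := by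
  have key : ∀ n, n ≤ N → Y n = X n - ∑ i ∈ Finset.Icc 1 n, s i := by
    intro n
    induction n with
    | zero => intro _; simp [hY0]
    | succ k ih =>
      intro hk
      have hYk := ih (by omega)
      have hsum : ∑ i ∈ Finset.Icc 1 (k + 1), s i ∈ V (k + 1) := by
        refine Submodule.sum_mem _ fun i hi => hVs _ hk (hs i ?_ ?_) <;>
          simp only [Finset.mem_Icc] at hi <;> omega
      set e := Y (k + 1) - (X (k + 1) - ∑ i ∈ Finset.Icc 1 (k + 1), s i) with he
      have hmem : e ∈ V (k + 1) := sub_mem (hY _ hk) (sub_mem (hX _ hk) hsum)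
      have hx := hXeq (k + 1) (by omega) hk e hmem
      have hy := hYeq (k + 1) (by omega) hk e hmem
      rw [Nat.add_sub_cancel] at hx hy
      have hdecomp : e = (Y (k + 1) - Y k) - (X (k + 1) - X k) + s (k + 1) := by
        rw [he, Finset.sum_Icc_succ_top (by omega), hYk]
        abel
      have hzero : ⟪e, e⟫ = 0 := by
        calc ⟪e, e⟫ = ⟪(Y (k + 1) - Y k) - (X (k + 1) - X k) + s (k + 1), e⟫ := by
              rw [← hdecomp]
          _ = 0 := by
              rw [inner_add_left, inner_sub_left, hx, hy]
              ring
      exact sub_eq_zero.mp (inner_self_eq_zero.mp hzero)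
  exact fun n _ hn => key n hn
end

section
/- Let E be a real inner product space and let ε > 0. Then for all a, b ∈ E one has ⟨a/√(‖a‖² + ε²) − b/√(‖b‖² + ε²), a − b⟩ ≥ (1 − ‖b‖/√(‖b‖² + ε²)) · ‖a − b‖² / √(‖a‖² + ε²). -/
open RealInnerProductSpace

/-- The map `x ↦ √(x² + ε²)` is 1-Lipschitz. -/
theorem abs_sqrt_sq_add_sq_sub_le (ε x y : ℝ) :
    |Real.sqrt (x ^ 2 + ε ^ 2) - Real.sqrt (y ^ 2 + ε ^ 2)| ≤ |x - y| := by
  have hx := Real.sq_sqrt (show 0 ≤ x ^ 2 + ε ^ 2 by positivity)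
  have hy := Real.sq_sqrt (show 0 ≤ y ^ 2 + ε ^ 2 by positivity)
  have h : x * y + ε ^ 2 ≤ Real.sqrt (x ^ 2 + ε ^ 2) * Real.sqrt (y ^ 2 + ε ^ 2) := by
    refine le_of_abs_le (abs_le_of_sq_le_sq ?_ (by positivity))
    rw [mul_pow, hx, hy]
    nlinarith [sq_nonneg (ε * (x - y))]
  rw [← sq_le_sq]
  nlinarith

/-- Pointwise coercivity lower bound for the regularized TV nonlinearity. -/
theorem stmt_6 {E : Type*} [NormedAddCommGroup E] [InnerProductSpace ℝ E]
    (ε : ℝ) (hε : 0 < ε) (a b : E) :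
    ⟪(Real.sqrt (‖a‖ ^ 2 + ε ^ 2))⁻¹ • a - (Real.sqrt (‖b‖ ^ 2 + ε ^ 2))⁻¹ • b,
        a - b⟫ ≥
      (1 - ‖b‖ / Real.sqrt (‖b‖ ^ 2 + ε ^ 2)) * ‖a - b‖ ^ 2 /
        Real.sqrt (‖a‖ ^ 2 + ε ^ 2) := by
  have hlip := (abs_sqrt_sq_add_sq_sub_le ε ‖a‖ ‖b‖).trans (abs_norm_sub_norm_le a b)
  have hp : 0 < Real.sqrt (‖a‖ ^ 2 + ε ^ 2) := by positivity
  have hq : 0 < Real.sqrt (‖b‖ ^ 2 + ε ^ 2) := by positivity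
  generalize Real.sqrt (‖a‖ ^ 2 + ε ^ 2) = p at *
  generalize Real.sqrt (‖b‖ ^ 2 + ε ^ 2) = q at *
  have hsplit : p⁻¹ • a - q⁻¹ • b = p⁻¹ • (a - b) - ((p - q) / (p * q)) • b := by
    have hpq : (p - q) / (p * q) = q⁻¹ - p⁻¹ := by field_simp
    rw [hpq]
    module
  have hcross : (p - q) * ⟪b, a - b⟫ ≤ ‖a - b‖ * (‖b‖ * ‖a - b‖) := by
    refine (le_abs_self _).trans ?_
    rw [abs_mul]
    exact mul_le_mul hlip (abs_real_inner_le_norm b (a - b)) (abs_nonneg _) (norm_nonneg _)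
  rw [hsplit, inner_sub_left, real_inner_smul_left, real_inner_smul_left,
    real_inner_self_eq_norm_sq, ge_iff_le, ← sub_nonneg]
  have hdiff : p⁻¹ * ‖a - b‖ ^ 2 - (p - q) / (p * q) * ⟪b, a - b⟫ -
      (1 - ‖b‖ / q) * ‖a - b‖ ^ 2 / p =
      (‖a - b‖ * (‖b‖ * ‖a - b‖) - (p - q) * ⟪b, a - b⟫) / (p * q) := by
    field_simp
    ring
  rw [hdiff]
  exact div_nonneg (sub_nonneg.2 hcross) (by positivity)
end

section
/- Let E be a real inner product space and let ε > 0. Then for all a, b ∈ E one has ⟨a/√(‖a‖² + ε²) − b/√(‖b‖² + ε²), a − b⟩ ≥ 0, i.e., the map v ↦ v/√(‖v‖² + ε²) is monotone on E. -/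
open RealInnerProductSpace

/-- Cauchy–Schwarz inequality for the augmented vectors `(a, ε)` and `(b, ε)`. -/
theorem inner_add_sq_le_sqrt_mul_sqrt {E : Type*} [NormedAddCommGroup E] [InnerProductSpace ℝ E]
    (ε : ℝ) (a b : E) :
    ⟪a, b⟫ + ε ^ 2 ≤ Real.sqrt (‖a‖ ^ 2 + ε ^ 2) * Real.sqrt (‖b‖ ^ 2 + ε ^ 2) := by
  rw [← Real.sqrt_mul (by positivity)]
  calc ⟪a, b⟫ + ε ^ 2 ≤ ‖a‖ * ‖b‖ + ε ^ 2 := by gcongr; exact real_inner_le_norm a b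
    _ ≤ _ := Real.le_sqrt_of_sq_le (by nlinarith [sq_nonneg (ε * (‖a‖ - ‖b‖))])

/-- Monotonicity of the regularized TV nonlinearity `v ↦ v/|v|_ε`. -/
theorem stmt_7 {E : Type*} [NormedAddCommGroup E] [InnerProductSpace ℝ E]
    (ε : ℝ) (hε : 0 < ε) (a b : E) :
    ⟪(Real.sqrt (‖a‖ ^ 2 + ε ^ 2))⁻¹ • a - (Real.sqrt (‖b‖ ^ 2 + ε ^ 2))⁻¹ • b,
        a - b⟫ ≥ 0 := by
  have hle := inner_add_sq_le_sqrt_mul_sqrt ε a b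
  have hs : 0 < Real.sqrt (‖a‖ ^ 2 + ε ^ 2) := by positivity
  have ht : 0 < Real.sqrt (‖b‖ ^ 2 + ε ^ 2) := by positivity
  have hs2 : Real.sqrt (‖a‖ ^ 2 + ε ^ 2) ^ 2 = ‖a‖ ^ 2 + ε ^ 2 := Real.sq_sqrt (by positivity)
  have ht2 : Real.sqrt (‖b‖ ^ 2 + ε ^ 2) ^ 2 = ‖b‖ ^ 2 + ε ^ 2 := Real.sq_sqrt (by positivity)
  simp only [inner_sub_left, inner_sub_right, real_inner_smul_left, real_inner_self_eq_norm_sq,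
    real_inner_comm a b]
  generalize Real.sqrt (‖a‖ ^ 2 + ε ^ 2) = s at *
  generalize Real.sqrt (‖b‖ ^ 2 + ε ^ 2) = t at *
  have key : 0 ≤ (s⁻¹ + t⁻¹) * (s * t - (⟪a, b⟫ + ε ^ 2)) :=
    mul_nonneg (by positivity) (sub_nonneg.2 hle)
  rw [eq_sub_of_add_eq hs2.symm, eq_sub_of_add_eq ht2.symm]
  convert key using 1
  field_simp
  ring
end

section
/- Let E be a real inner product space and let ε₁, ε₂ > 0. Then for all a, b ∈ E one has ⟨a/√(‖a‖² + ε₁²) − b/√(‖b‖² + ε₂²), a − b⟩ ≥ −2|ε₁ − ε₂|; in particular this pairing is bounded below by −2(ε₁ + ε₂). -/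
open RealInnerProductSpace

/-- Cauchy-Schwarz for the vectors `(a, s)` and `(b, t)` of `E × ℝ`. -/
theorem inner_add_mul_le_sqrt_mul_sqrt {E : Type*} [NormedAddCommGroup E]
    [InnerProductSpace ℝ E] (s t : ℝ) (a b : E) :
    ⟪a, b⟫ + s * t ≤ Real.sqrt (‖a‖ ^ 2 + s ^ 2) * Real.sqrt (‖b‖ ^ 2 + t ^ 2) := by
  rw [← Real.sqrt_mul (by positivity)]
  refine (add_le_add_left (real_inner_le_norm a b) _).trans (Real.le_sqrt_of_sq_le ?_)
  nlinarith [sq_nonneg (‖a‖ * t - ‖b‖ * s)]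

/-- Mixed-parameter quasi-monotonicity, with the sharper constant `1`. -/
theorem neg_abs_sub_le_inner_regularized_sub {E : Type*} [NormedAddCommGroup E]
    [InnerProductSpace ℝ E] {s t : ℝ} (hs : 0 < s) (ht : 0 < t) (a b : E) :
    -|s - t| ≤ ⟪(Real.sqrt (‖a‖ ^ 2 + s ^ 2))⁻¹ • a - (Real.sqrt (‖b‖ ^ 2 + t ^ 2))⁻¹ • b,
        a - b⟫ := by
  have hcs := inner_add_mul_le_sqrt_mul_sqrt s t a b
  have hP : 0 < Real.sqrt (‖a‖ ^ 2 + s ^ 2) := by positivity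
  have hQ : 0 < Real.sqrt (‖b‖ ^ 2 + t ^ 2) := by positivity
  have hP2 := Real.sq_sqrt (show 0 ≤ ‖a‖ ^ 2 + s ^ 2 by positivity)
  have hQ2 := Real.sq_sqrt (show 0 ≤ ‖b‖ ^ 2 + t ^ 2 by positivity)
  have hsP : s ≤ Real.sqrt (‖a‖ ^ 2 + s ^ 2) :=
    Real.le_sqrt_of_sq_le (le_add_of_nonneg_left (sq_nonneg _))
  have htQ : t ≤ Real.sqrt (‖b‖ ^ 2 + t ^ 2) :=
    Real.le_sqrt_of_sq_le (le_add_of_nonneg_left (sq_nonneg _))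
  simp only [inner_sub_left, inner_sub_right, real_inner_smul_left,
    real_inner_self_eq_norm_sq, real_inner_comm a b]
  set P := Real.sqrt (‖a‖ ^ 2 + s ^ 2)
  set Q := Real.sqrt (‖b‖ ^ 2 + t ^ 2)
  rw [show ‖a‖ ^ 2 = P ^ 2 - s ^ 2 by linarith, show ‖b‖ ^ 2 = Q ^ 2 - t ^ 2 by linarith]
  have hweight : |t / Q - s / P| ≤ 1 := by
    have h₁ : s / P ≤ 1 := (div_le_one hP).2 hsP
    have h₂ : t / Q ≤ 1 := (div_le_one hQ).2 htQ
    have h₃ : 0 < s / P := div_pos hs hP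
    have h₄ : 0 < t / Q := div_pos ht hQ
    exact abs_le.2 ⟨by linarith, by linarith⟩
  have hprod : -|s - t| ≤ (s - t) * (t / Q - s / P) := by
    refine le_trans ?_ (neg_abs_le _)
    rw [abs_mul]
    exact neg_le_neg (mul_le_of_le_one_right (abs_nonneg _) hweight)
  have hgap : 0 ≤ (P * Q - s * t - ⟪a, b⟫) * (P⁻¹ + Q⁻¹) :=
    mul_nonneg (by linarith) (by positivity)
  refine hprod.trans (le_of_sub_nonneg (hgap.trans_eq ?_))
  field_simp
  ring

/-- Mixed-parameter quasi-monotonicity lower bound for the regularized TV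
nonlinearities with parameters `ε₁` and `ε₂`. -/
theorem stmt_9 {E : Type*} [NormedAddCommGroup E] [InnerProductSpace ℝ E]
    (ε₁ ε₂ : ℝ) (hε₁ : 0 < ε₁) (hε₂ : 0 < ε₂) (a b : E) :
    ⟪(Real.sqrt (‖a‖ ^ 2 + ε₁ ^ 2))⁻¹ • a - (Real.sqrt (‖b‖ ^ 2 + ε₂ ^ 2))⁻¹ • b,
        a - b⟫ ≥ -(2 * |ε₁ - ε₂|) ∧
    ⟪(Real.sqrt (‖a‖ ^ 2 + ε₁ ^ 2))⁻¹ • a - (Real.sqrt (‖b‖ ^ 2 + ε₂ ^ 2))⁻¹ • b,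
        a - b⟫ ≥ -(2 * (ε₁ + ε₂)) := by
  have h := neg_abs_sub_le_inner_regularized_sub hε₁ hε₂ a b
  have habs : |ε₁ - ε₂| ≤ ε₁ + ε₂ := abs_le.2 ⟨by linarith, by linarith⟩
  have hnonneg := abs_nonneg (ε₁ - ε₂)
  exact ⟨by linarith, by linarith⟩
end

section
/- Let E be a real inner product space, let ε ≥ 0 and let p ∈ E. Then the supremum of the quantity ⟨p, v⟩ + ε·√(1 − ‖v‖²) over all v ∈ E with ‖v‖ ≤ 1 equals √(‖p‖² + ε²). Moreover, if ‖p‖² + ε² > 0 the supremum is attained at v = p/√(‖p‖² + ε²). -/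
open RealInnerProductSpace

theorem inner_add_mul_sqrt_one_sub_le {E : Type*} [NormedAddCommGroup E] [InnerProductSpace ℝ E]
    (ε : ℝ) (p : E) {v : E} (hv : ‖v‖ ≤ 1) :
    ⟪p, v⟫ + ε * Real.sqrt (1 - ‖v‖ ^ 2) ≤ Real.sqrt (‖p‖ ^ 2 + ε ^ 2) := by
  have h1 : ‖v‖ ^ 2 ≤ 1 := pow_le_one₀ (norm_nonneg v) hv
  have h2 : Real.sqrt (1 - ‖v‖ ^ 2) ^ 2 = 1 - ‖v‖ ^ 2 := Real.sq_sqrt (by linarith)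
  have h3 : ⟪p, v⟫ ≤ ‖p‖ * ‖v‖ := real_inner_le_norm p v
  set t := Real.sqrt (1 - ‖v‖ ^ 2)
  have h4 : ‖p‖ * ‖v‖ + ε * t ≤ Real.sqrt (‖p‖ ^ 2 + ε ^ 2) := by
    apply Real.le_sqrt_of_sq_le
    calc (‖p‖ * ‖v‖ + ε * t) ^ 2
        ≤ (‖p‖ ^ 2 + ε ^ 2) * (‖v‖ ^ 2 + t ^ 2) := by
          linarith [sq_nonneg (‖p‖ * t - ε * ‖v‖)]
      _ = ‖p‖ ^ 2 + ε ^ 2 := by rw [h2]; ring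
  linarith

theorem norm_inv_sqrt_smul_sq {E : Type*} [NormedAddCommGroup E] [InnerProductSpace ℝ E]
    (ε : ℝ) (p : E) :
    ‖(Real.sqrt (‖p‖ ^ 2 + ε ^ 2))⁻¹ • p‖ ^ 2 = ‖p‖ ^ 2 / (‖p‖ ^ 2 + ε ^ 2) := by
  rw [norm_smul, mul_pow, Real.norm_eq_abs, sq_abs, inv_pow, Real.sq_sqrt (by positivity)]
  ring

theorem norm_inv_sqrt_smul_le_one {E : Type*} [NormedAddCommGroup E] [InnerProductSpace ℝ E]
    (ε : ℝ) (p : E) : ‖(Real.sqrt (‖p‖ ^ 2 + ε ^ 2))⁻¹ • p‖ ≤ 1 := by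
  rw [← sq_le_one_iff₀ (norm_nonneg _), norm_inv_sqrt_smul_sq]
  exact div_le_one_of_le₀ (by linarith [sq_nonneg ε]) (by positivity)

/-- The value at `v = p/√(‖p‖² + ε²)`; for `p = 0` and `ε = 0` both sides vanish. -/
theorem inner_add_mul_sqrt_one_sub_eq {E : Type*} [NormedAddCommGroup E]
    [InnerProductSpace ℝ E] (ε : ℝ) (hε : 0 ≤ ε) (p : E) :
    ⟪p, (Real.sqrt (‖p‖ ^ 2 + ε ^ 2))⁻¹ • p⟫ +
        ε * Real.sqrt (1 - ‖(Real.sqrt (‖p‖ ^ 2 + ε ^ 2))⁻¹ • p‖ ^ 2) =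
      Real.sqrt (‖p‖ ^ 2 + ε ^ 2) := by
  rcases (by positivity : 0 ≤ ‖p‖ ^ 2 + ε ^ 2).eq_or_lt with h | h
  · have hp : p = 0 := norm_eq_zero.mp (by nlinarith [sq_nonneg ε, sq_nonneg ‖p‖])
    have he : ε = 0 := by nlinarith [sq_nonneg ‖p‖]
    simp [hp, he]
  · have h1 : 1 - ‖p‖ ^ 2 / (‖p‖ ^ 2 + ε ^ 2) = ε ^ 2 / (‖p‖ ^ 2 + ε ^ 2) := by
      field_simp
      ring
    rw [norm_inv_sqrt_smul_sq, h1, Real.sqrt_div (sq_nonneg ε), Real.sqrt_sq hε,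
      real_inner_smul_right, real_inner_self_eq_norm_sq]
    have hs : 0 < Real.sqrt (‖p‖ ^ 2 + ε ^ 2) := Real.sqrt_pos.mpr h
    have hq : Real.sqrt (‖p‖ ^ 2 + ε ^ 2) ^ 2 = ‖p‖ ^ 2 + ε ^ 2 := Real.sq_sqrt h.le
    set s := Real.sqrt (‖p‖ ^ 2 + ε ^ 2)
    field_simp
    linarith

/-- Pointwise duality formula: `sup_{‖v‖ ≤ 1} (⟨p, v⟩ + ε√(1 − ‖v‖²)) = √(‖p‖² + ε²)`,
with the supremum attained at `v = p/√(‖p‖² + ε²)` whenever `‖p‖² + ε² > 0`. -/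
theorem stmt_10 {E : Type*} [NormedAddCommGroup E] [InnerProductSpace ℝ E]
    (ε : ℝ) (hε : 0 ≤ ε) (p : E) :
    IsLUB ((fun v : E => ⟪p, v⟫ + ε * Real.sqrt (1 - ‖v‖ ^ 2)) ''
        {v : E | ‖v‖ ≤ 1})
      (Real.sqrt (‖p‖ ^ 2 + ε ^ 2)) ∧
    (0 < ‖p‖ ^ 2 + ε ^ 2 →
      ‖(Real.sqrt (‖p‖ ^ 2 + ε ^ 2))⁻¹ • p‖ ≤ 1 ∧
      ⟪p, (Real.sqrt (‖p‖ ^ 2 + ε ^ 2))⁻¹ • p⟫ +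
          ε * Real.sqrt (1 - ‖(Real.sqrt (‖p‖ ^ 2 + ε ^ 2))⁻¹ • p‖ ^ 2) =
        Real.sqrt (‖p‖ ^ 2 + ε ^ 2)) := by
  refine ⟨IsGreatest.isLUB ⟨⟨_, norm_inv_sqrt_smul_le_one ε p,
    inner_add_mul_sqrt_one_sub_eq ε hε p⟩, ?_⟩, fun _ =>
    ⟨norm_inv_sqrt_smul_le_one ε p, inner_add_mul_sqrt_one_sub_eq ε hε p⟩⟩
  rintro _ ⟨v, hv, rfl⟩
  exact inner_add_mul_sqrt_one_sub_le ε p hv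
end
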